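/- Fix n ≥ 1. Let T be an n-globular set in which every cell of positive dimension has equal source and target. Let i : I → T be a morphism of n-globular sets that is full (k-full for all 1 ≤ k ≤ n) and n-faithful, let g : G → T be a morphism of n-globular sets, and let u : I → G be a morphism of n-globular sets with g ∘ u = i. If u is surjective on 0-cells and full, then g is full and n-faithful. (This is the statement that every n-globular operad for n-categories is contractible.) -/

import Mathlib

/-- An `n`-globular set: sets of `k`-cells for `0 ≤ k ≤ n`, with source and target
maps satisfying the globular identities.  (Cells in dimensions above `n` play no
role in any definition below.) -/
structure NGlob (n : ℕ) : Type 1 where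
  cell : ℕ → Type
  src : ∀ k, k < n → cell (k + 1) → cell k
  tgt : ∀ k, k < n → cell (k + 1) → cell k
  src_src : ∀ k (h : k + 1 < n) (x : cell (k + 2)),
    src k (Nat.lt_of_succ_lt h) (src (k + 1) h x) =
      src k (Nat.lt_of_succ_lt h) (tgt (k + 1) h x)
  tgt_tgt : ∀ k (h : k + 1 < n) (x : cell (k + 2)),
    tgt k (Nat.lt_of_succ_lt h) (src (k + 1) h x) =
      tgt k (Nat.lt_of_succ_lt h) (tgt (k + 1) h x)

/-- A morphism of `n`-globular sets: a family of maps in dimensions `0,…,n`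
commuting with sources and targets. -/
structure NGlobMap {n : ℕ} (G H : NGlob n) where
  app : ∀ k, k ≤ n → G.cell k → H.cell k
  comm_src : ∀ k (h : k < n) (x : G.cell (k + 1)),
    app k (Nat.le_of_lt h) (G.src k h x) = H.src k h (app (k + 1) h x)
  comm_tgt : ∀ k (h : k < n) (x : G.cell (k + 1)),
    app k (Nat.le_of_lt h) (G.tgt k h x) = H.tgt k h (app (k + 1) h x)

/-- Two `k`-cells are parallel if they have the same source and target;
all pairs of `0`-cells are parallel. -/
def NGlob.Parallel {n : ℕ} (G : NGlob n) : ∀ k, k ≤ n → G.cell k → G.cell k → Prop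
  | 0, _, _, _ => True
  | k + 1, h, x, x' => G.src k h x = G.src k h x' ∧ G.tgt k h x = G.tgt k h x'

/-- `f` is `(k+1)`-full: for every parallel pair `(x, x')` of `k`-cells of `G`,
every `(k+1)`-cell of `H` from `f x` to `f x'` is the image of a `(k+1)`-cell of
`G` from `x` to `x'`. -/
def NGlobMap.KFull {n : ℕ} {G H : NGlob n} (f : NGlobMap G H) (k : ℕ) (h : k < n) : Prop :=
  ∀ x x' : G.cell k, G.Parallel k (Nat.le_of_lt h) x x' →
    ∀ ψ : H.cell (k + 1), H.src k h ψ = f.app k (Nat.le_of_lt h) x →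
      H.tgt k h ψ = f.app k (Nat.le_of_lt h) x' →
        ∃ χ : G.cell (k + 1), G.src k h χ = x ∧ G.tgt k h χ = x' ∧ f.app (k + 1) h χ = ψ

/-- `f` is full: `k`-full for every `1 ≤ k ≤ n`. -/
def NGlobMap.Full {n : ℕ} {G H : NGlob n} (f : NGlobMap G H) : Prop :=
  ∀ k (h : k < n), f.KFull k h

/-- `f` is `(k+1)`-faithful: for every parallel pair of `(k+1)`-cells of `G`
(having the same source and the same target), equal images under `f` imply
the cells are equal. -/
def NGlobMap.KFaithful {n : ℕ} {G H : NGlob n} (f : NGlobMap G H) (k : ℕ) (h : k < n) : Prop :=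
  ∀ χ χ' : G.cell (k + 1), G.src k h χ = G.src k h χ' → G.tgt k h χ = G.tgt k h χ' →
    f.app (k + 1) h χ = f.app (k + 1) h χ' → χ = χ'

/-- The source and target of a positive-dimensional cell are parallel. -/
theorem NGlob.parallel_src_tgt {n : ℕ} (G : NGlob n) :
    ∀ k (h : k < n) (x : G.cell (k + 1)),
      G.Parallel k (Nat.le_of_lt h) (G.src k h x) (G.tgt k h x)
  | 0, _, _ => trivial
  | k + 1, h, x => ⟨G.src_src k h x, G.tgt_tgt k h x⟩

/-- A full morphism that is surjective on `0`-cells lifts parallel pairs of cells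
to parallel pairs of cells. -/
theorem NGlobMap.Full.exists_parallel_lift {n : ℕ} {I G : NGlob n} {u : NGlobMap I G}
    (hu : u.Full) (hu0 : Function.Surjective (u.app 0 (Nat.zero_le n))) :
    ∀ k (h : k ≤ n) (a a' : G.cell k), G.Parallel k h a a' →
      ∃ x x' : I.cell k, I.Parallel k h x x' ∧ u.app k h x = a ∧ u.app k h x' = a'
  | 0, _, a, a', _ => by
    obtain ⟨x, hx⟩ := hu0 a
    obtain ⟨x', hx'⟩ := hu0 a'
    exact ⟨x, x', trivial, hx, hx'⟩
  | k + 1, h, a, a', ⟨hs, ht⟩ => by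
    obtain ⟨y, y', hy, hya, hya'⟩ := exists_parallel_lift hu hu0 k (Nat.le_of_lt h) _ _
      (G.parallel_src_tgt k h a)
    obtain ⟨x, hxs, hxt, hx⟩ := hu k h y y' hy a hya.symm hya'.symm
    obtain ⟨x', hxs', hxt', hx'⟩ := hu k h y y' hy a'
      (hs.symm.trans hya.symm) (ht.symm.trans hya'.symm)
    exact ⟨x, x', ⟨hxs.trans hxs'.symm, hxt.trans hxt'.symm⟩, hx, hx'⟩

/-- For `n ≥ 1` (here the paper's `n` is `n + 1`): let `T` be an `(n+1)`-globular
set whose positive-dimensional cells have equal source and target, `i : I → T` a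
morphism that is full and faithful in the top dimension, `g : G → T` a morphism,
and `u : I → G` a morphism with `g ∘ u = i`.  If `u` is surjective on `0`-cells
and full, then `g` is full and faithful in the top dimension. -/
theorem stmt7 (n : ℕ) {I G T : NGlob (n + 1)}
    (hT : ∀ k (hk : k < n + 1) (τ : T.cell (k + 1)), T.src k hk τ = T.tgt k hk τ)
    (i : NGlobMap I T)
    (hiFull : i.Full) (hiFaithful : i.KFaithful n (Nat.lt_succ_self n))
    (g : NGlobMap G T) (u : NGlobMap I G)
    (hcomm : ∀ k (hk : k ≤ n + 1) (x : I.cell k), g.app k hk (u.app k hk x) = i.app k hk x)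
    (hu0 : Function.Surjective (u.app 0 (Nat.zero_le (n + 1))))
    (huFull : u.Full) :
    g.Full ∧ g.KFaithful n (Nat.lt_succ_self n) := by
  refine ⟨fun k hk a a' haa' ψ hs ht => ?_, fun a a' hs ht haa' => ?_⟩
  · obtain ⟨x, x', hxx', rfl, rfl⟩ :=
      huFull.exists_parallel_lift hu0 k (Nat.le_of_lt hk) a a' haa'
    obtain ⟨χ, rfl, rfl, hχ⟩ :=
      hiFull k hk x x' hxx' ψ (hs.trans (hcomm _ _ _)) (ht.trans (hcomm _ _ _))
    exact ⟨u.app (k + 1) hk χ, (u.comm_src k hk χ).symm, (u.comm_tgt k hk χ).symm,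
      (hcomm _ _ _).trans hχ⟩
  · obtain ⟨x, x', ⟨hxs, hxt⟩, rfl, rfl⟩ :=
      huFull.exists_parallel_lift hu0 (n + 1) le_rfl a a' ⟨hs, ht⟩
    rw [hcomm, hcomm] at haa'
    rw [hiFaithful x x' hxs hxt haa']
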